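/- Low-density rates under general exponential tails: assume Z finite, the low-density condition P_{X∼ρ_X}(d(g*(X),F) < t) ≤ c_α t^α for all t > 0, and that for some positive constants (a_i, b_i, p_i)_{i≤m}, for all x ∈ supp ρ_X and t > 0, P(‖g_n(ω,x) − g*(x)‖ > t) ≤ Σ_{i=1}^m a_i exp(−b_i t^{p_i}). Then there exists c > 0, depending only on α, c_α, c_ψ, m and (p_i) but not on (a_i, b_i), such that E_ω[R(f_n(ω))] − R(f*) ≤ c Σ_{i=1}^m a_i b_i^{−(α+1)/p_i}. -/

import Mathlib

open MeasureTheory ProbabilityTheory Real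
open scoped RealInnerProductSpace ENNReal

noncomputable section

universe uX uY uZ uH uO

variable {X Y Z H : Type*}
variable [MeasurableSpace X] [MeasurableSpace Y]
variable [Fintype Z] [Nonempty Z] [MeasurableSpace Z] [MeasurableSingletonClass Z]
variable [NormedAddCommGroup H] [InnerProductSpace ℝ H] [CompleteSpace H]

/-- The risk of a predictor `f : X → Z` for the loss `ℓ(z, y) = ⟪ψ z, φ y⟫`. -/
def risk (ψ : Z → H) (φ : Y → H) (ρ : Measure (X × Y)) (f : X → Z) : ℝ :=
  ∫ p, ⟪ψ (f p.1), φ p.2⟫ ∂ρ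

/-- The surrogate conditional mean `g*(x) = E_{Y ∼ ρ|ₓ}[φ(Y)]`, where `κ x = ρ|ₓ`. -/
def gStar (φ : Y → H) (κ : Kernel X Y) (x : X) : H :=
  ∫ y, φ y ∂(κ x)

/-- `f` is a (measurable) decoding of `g : X → H`. -/
def IsDecoding (ψ : Z → H) (g : X → H) (f : X → Z) : Prop :=
  Measurable f ∧ ∀ x z, ⟪ψ (f x), g x⟫ ≤ ⟪ψ z, g x⟫

/-- The decision frontier `F`. -/
def decisionFrontier (ψ : Z → H) : Set H :=
  {ξ | ∃ z₁ z₂ : Z, z₁ ≠ z₂ ∧ (∀ z, ⟪ψ z₁, ξ⟫ ≤ ⟪ψ z, ξ⟫) ∧ ∀ z, ⟪ψ z₂, ξ⟫ ≤ ⟪ψ z, ξ⟫}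

/-- Distance (in `ℝ≥0∞`) from a point to the decision frontier. -/
def dF (ψ : Z → H) (ξ : H) : ℝ≥0∞ :=
  EMetric.infEdist ξ (decisionFrontier ψ)

/-- The (topological) support of a measure. -/
def msupp {W : Type*} [TopologicalSpace W] [MeasurableSpace W] (μ : Measure W) : Set W :=
  {x | ∀ U : Set W, IsOpen U → x ∈ U → 0 < μ U}

lemma aux_dF_le (ψ : Z → H) {ξ η : H} {z1 z2 : Z} (hne : z1 ≠ z2)
    (h1 : ∀ z, ⟪ψ z1, ξ⟫ ≤ ⟪ψ z, ξ⟫) (h2 : ∀ z, ⟪ψ z2, η⟫ ≤ ⟪ψ z, η⟫) :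
    dF ψ ξ ≤ ENNReal.ofReal ‖η - ξ‖ := by
  let A : Z → Set ℝ := fun z1 => {t | ∀ z, ⟪ψ z1, ξ + t • (η - ξ)⟫ ≤ ⟪ψ z, ξ + t • (η - ξ)⟫}
  have hA : ∀ z, IsClosed (A z) := by
    intro z0
    have : A z0 = ⋂ z, {t | ⟪ψ z0, ξ + t • (η - ξ)⟫ ≤ ⟪ψ z, ξ + t • (η - ξ)⟫} := by
      ext t; simp [A]
    rw [this]
    exact isClosed_iInter fun z => isClosed_le (by fun_prop) (by fun_prop)
  have hB : IsClosed (⋃ z : {z : Z // z ≠ z1}, A z) := isClosed_iUnion_of_finite fun z => hA z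
  obtain ⟨t, ht, ht1, ht2⟩ := isPreconnected_closed_iff.1 (isPreconnected_Icc (a := (0:ℝ)) (b := 1))
    (A z1) (⋃ z : {z : Z // z ≠ z1}, A z) (hA z1) hB
    (by
      intro t _
      obtain ⟨z, hz⟩ := Finite.exists_min (fun z => ⟪ψ z, ξ + t • (η - ξ)⟫)
      by_cases h : z = z1
      · left; rw [← h]; exact hz
      · right; exact Set.mem_iUnion.2 ⟨⟨z, h⟩, hz⟩)
    ⟨0, by simp, by simpa [A] using h1⟩
    ⟨1, by simp, Set.mem_iUnion.2 ⟨⟨z2, hne.symm⟩, by simpa [A] using h2⟩⟩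
  obtain ⟨⟨z, hz⟩, hzt⟩ := Set.mem_iUnion.1 ht2
  have hmem : ξ + t • (η - ξ) ∈ decisionFrontier ψ := ⟨z1, z, hz.symm, ht1, hzt⟩
  refine (Metric.infEDist_le_edist_of_mem hmem).trans ?_
  rw [edist_dist, dist_eq_norm]
  apply ENNReal.ofReal_le_ofReal
  rw [show ξ - (ξ + t • (η - ξ)) = -(t • (η - ξ)) by abel, norm_neg, norm_smul]
  have : ‖t‖ ≤ 1 := by rw [Real.norm_eq_abs, abs_of_nonneg ht.1]; exact ht.2
  exact mul_le_of_le_one_left (norm_nonneg _) this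

lemma aux_tail (w : ℝ) (hw : 0 ≤ w) (d : ℝ≥0∞) (h : d ≤ ENNReal.ofReal w) :
    ENNReal.ofReal w ≤ 2 * ∫⁻ t in Set.Ioi (0:ℝ),
      Set.indicator {t : ℝ | d < ENNReal.ofReal (2 * t) ∧ t < w} 1 t := by
  have h1 : Set.Ioo (w/2) w ⊆ {t : ℝ | d < ENNReal.ofReal (2 * t) ∧ t < w} ∩ Set.Ioi 0 := by
    intro t ht
    refine ⟨⟨h.trans_lt ((ENNReal.ofReal_lt_ofReal_iff (by linarith [ht.1])).2
      (by linarith [ht.1])), ht.2⟩, by simp only [Set.mem_Ioi]; linarith [ht.1]⟩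
  calc ENNReal.ofReal w = 2 * volume (Set.Ioo (w/2) w) := by
        rw [Real.volume_Ioo, show (2:ℝ≥0∞) = ENNReal.ofReal 2 by simp,
          ← ENNReal.ofReal_mul (by norm_num)]
        congr 1; ring
    _ = 2 * ∫⁻ t in Set.Ioi (0:ℝ), Set.indicator (Set.Ioo (w/2) w) 1 t := by
        rw [lintegral_indicator_one measurableSet_Ioo, Measure.restrict_apply measurableSet_Ioo,
          Set.inter_eq_left.2 (fun t ht => (h1 ht).2)]
    _ ≤ _ := by
        gcongr with t
        exact fun t ht => (h1 ht).1

lemma aux_integral (α cα : ℝ) (hα : 0 < α) (hcα : 0 < cα) (m : ℕ) (p : Fin m → ℝ)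
    (hp : ∀ i, 0 < p i) (a b : Fin m → ℝ) (ha : ∀ i, 0 < a i) (hb : ∀ i, 0 < b i) :
    ∫⁻ t in Set.Ioi (0:ℝ), ENNReal.ofReal (∑ i, a i * exp (-(b i * t ^ (p i)))) *
      ENNReal.ofReal (cα * (2 * t) ^ α)
    = ENNReal.ofReal (∑ i, (cα * 2 ^ α * (1 / p i) * Gamma ((α + 1) / p i)) *
        (a i * b i ^ (-(α + 1) / p i))) := by
  have hint : ∀ i, IntegrableOn (fun t : ℝ => cα * 2 ^ α * a i * (t ^ α * exp (- b i * t ^ p i)))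
      (Set.Ioi 0) := fun i =>
    (integrableOn_rpow_mul_exp_neg_mul_rpow (by linarith) (hp i) (hb i)).const_mul _
  calc _ = ∫⁻ t in Set.Ioi (0:ℝ), ENNReal.ofReal
          (∑ i, cα * 2 ^ α * a i * (t ^ α * exp (- b i * t ^ p i))) := by
        refine setLIntegral_congr_fun measurableSet_Ioi fun t ht => ?_
        simp only [Set.mem_Ioi] at ht
        rw [← ENNReal.ofReal_mul (Finset.sum_nonneg fun i _ => mul_nonneg (ha i).le (exp_pos _).le),
          Finset.sum_mul, mul_rpow (by norm_num) ht.le]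
        congr 1
        refine Finset.sum_congr rfl fun i _ => ?_
        rw [neg_mul]; ring
    _ = ENNReal.ofReal (∫ t in Set.Ioi (0:ℝ),
          (∑ i, cα * 2 ^ α * a i * (t ^ α * exp (- b i * t ^ p i)))) := by
        rw [ofReal_integral_eq_lintegral_ofReal]
        · exact integrable_finsetSum _ fun i _ => hint i
        · filter_upwards [ae_restrict_mem measurableSet_Ioi] with t ht
          simp only [Set.mem_Ioi] at ht
          exact Finset.sum_nonneg fun i _ => by have := ha i; positivity
    _ = _ := by
        rw [integral_finsetSum _ fun i _ => hint i]
        congr 1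
        refine Finset.sum_congr rfl fun i _ => ?_
        rw [integral_const_mul, integral_rpow_mul_exp_neg_mul_rpow (hp i) (by linarith) (hb i)]
        ring

lemma aux_tonelli {X Ω : Type*} [MeasurableSpace X] [MeasurableSpace Ω]
    (α cα : ℝ) (hα : 0 < α) (hcα : 0 < cα) (m : ℕ) (p : Fin m → ℝ)
    (hp : ∀ i, 0 < p i) (a b : Fin m → ℝ) (ha : ∀ i, 0 < a i) (hb : ∀ i, 0 < b i)
    (μ : Measure X) [IsProbabilityMeasure μ] (P : Measure Ω) [IsProbabilityMeasure P]
    (W : Ω → X → ℝ) (hW : Measurable (Function.uncurry W)) (d : X → ℝ≥0∞) (hd : Measurable d)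
    (hm : ∀ t : ℝ, 0 < t → μ {x | d x < ENNReal.ofReal t} ≤ ENNReal.ofReal (cα * t ^ α))
    (ht : ∀ᵐ x ∂μ, ∀ t : ℝ, 0 < t → P {ω | t < W ω x}
            ≤ ENNReal.ofReal (∑ i, a i * exp (-(b i * t ^ (p i))))) :
    ∫⁻ ω, ∫⁻ x, (∫⁻ t in Set.Ioi (0:ℝ),
      Set.indicator {t : ℝ | d x < ENNReal.ofReal (2 * t) ∧ t < W ω x} 1 t) ∂μ ∂P
    ≤ ENNReal.ofReal (∑ i, (cα * 2 ^ α * (1 / p i) * Gamma ((α + 1) / p i)) *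
        (a i * b i ^ (-(α + 1) / p i))) := by
  let S : Set (Ω × X × ℝ) := {q | d q.2.1 < ENNReal.ofReal (2 * q.2.2) ∧ q.2.2 < W q.1 q.2.1}
  have hS : MeasurableSet S := by
    apply MeasurableSet.inter
    · exact measurableSet_lt (hd.comp (measurable_fst.comp measurable_snd)) (f := fun q : Ω × X × ℝ => d q.2.1)
        (g := fun q => ENNReal.ofReal (2 * q.2.2)) (by fun_prop)
    · refine measurableSet_lt (measurable_snd.comp measurable_snd) ?_
      exact hW.comp (measurable_fst.prodMk (measurable_fst.comp measurable_snd))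
  let F : Ω → X → ℝ → ℝ≥0∞ := fun ω x t => S.indicator 1 (ω, x, t)
  have hF : Measurable (fun q : Ω × X × ℝ => F q.1 q.2.1 q.2.2) :=
    (measurable_one.indicator hS : Measurable (S.indicator (1 : Ω × X × ℝ → ℝ≥0∞)))
  have e1 : ∀ ω x t, Set.indicator {t : ℝ | d x < ENNReal.ofReal (2 * t) ∧ t < W ω x}
      (1 : ℝ → ℝ≥0∞) t = F ω x t := by
    intro ω x t
    simp [F, S, Set.indicator_apply]
  simp_rw [e1]
  have e2 : ∀ ω, ∫⁻ x, (∫⁻ t in Set.Ioi (0:ℝ), F ω x t) ∂μ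
      = ∫⁻ t in Set.Ioi (0:ℝ), ∫⁻ x, F ω x t ∂μ := by
    intro ω
    apply lintegral_lintegral_swap
    exact (hF.comp (measurable_const.prodMk measurable_id : Measurable
      (fun q : X × ℝ => (ω, q)))).aemeasurable
  simp_rw [e2]
  rw [lintegral_lintegral_swap]
  swap
  · apply Measurable.aemeasurable
    have : Measurable (fun r : (Ω × ℝ) × X => F r.1.1 r.2 r.1.2) :=
      hF.comp (by fun_prop : Measurable (fun r : (Ω × ℝ) × X => (r.1.1, r.2, r.1.2)))
    exact this.lintegral_prod_right'
  rw [← aux_integral α cα hα hcα m p hp a b ha hb]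
  refine setLIntegral_mono' measurableSet_Ioi fun t ht0 => ?_
  simp only [Set.mem_Ioi] at ht0
  rw [lintegral_lintegral_swap]
  swap
  · exact (hF.comp (by fun_prop : Measurable
      (fun q : Ω × X => (q.1, q.2, t)))).aemeasurable
  have hD : MeasurableSet {x | d x < ENNReal.ofReal (2 * t)} :=
    measurableSet_lt hd measurable_const
  calc ∫⁻ x, ∫⁻ ω, F ω x t ∂P ∂μ
      ≤ ∫⁻ x, Set.indicator {x | d x < ENNReal.ofReal (2 * t)}
          (fun _ => ENNReal.ofReal (∑ i, a i * exp (-(b i * t ^ (p i))))) x ∂μ := by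
        apply lintegral_mono_ae
        filter_upwards [ht] with x hx
        by_cases hdx : d x < ENNReal.ofReal (2 * t)
        · rw [Set.indicator_of_mem (by exact hdx)]
          refine le_trans (le_of_eq ?_) (hx t ht0)
          have hmx : MeasurableSet {ω | t < W ω x} := 
            measurableSet_lt measurable_const (hW.comp (by fun_prop : Measurable (fun ω => (ω, x))))
          rw [← lintegral_indicator_one hmx]
          refine lintegral_congr fun ω => ?_
          simp only [F, S, Set.indicator_apply, Set.mem_setOf_eq, hdx, true_and, Pi.one_apply]
        · simp only [F, S, Set.indicator_apply, Set.mem_setOf_eq, hdx, false_and, if_false,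
            lintegral_zero, le_refl]
    _ = ENNReal.ofReal (∑ i, a i * exp (-(b i * t ^ (p i)))) *
          μ {x | d x < ENNReal.ofReal (2 * t)} := lintegral_indicator_const hD _
    _ ≤ _ := by gcongr; exact hm _ (by positivity)

lemma aux_phi (φ : Y → H) (μ : Measure X) [IsProbabilityMeasure μ] (κ : Kernel X Y)
    [IsMarkovKernel κ] (hφ : StronglyMeasurable φ)
    (h : Integrable (fun pt : X × Y => ‖φ pt.2‖ ^ 2) (μ ⊗ₘ κ)) :
    Integrable (fun pt : X × Y => φ pt.2) (μ ⊗ₘ κ) := by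
  have hs : AEStronglyMeasurable (fun pt : X × Y => φ pt.2) (μ ⊗ₘ κ) :=
    (hφ.comp_measurable measurable_snd).aestronglyMeasurable
  exact ((memLp_two_iff_integrable_sq_norm hs).2 h).integrable one_le_two

lemma aux_risk (ψ : Z → H) (φ : Y → H) (μ : Measure X) [IsProbabilityMeasure μ] (κ : Kernel X Y)
    [IsMarkovKernel κ] (cψ : ℝ) (hψ : ∀ z, ‖ψ z‖ ≤ cψ)
    (hφ : Integrable (fun pt : X × Y => φ pt.2) (μ ⊗ₘ κ)) (f : X → Z) (hf : Measurable f) :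
    Integrable (fun x => ⟪ψ (f x), gStar φ κ x⟫) μ ∧
    risk ψ φ (μ ⊗ₘ κ) f = ∫ x, ⟪ψ (f x), gStar φ κ x⟫ ∂μ ∧
    |risk ψ φ (μ ⊗ₘ κ) f| ≤ ∫ q, cψ * ‖φ q.2‖ ∂(μ ⊗ₘ κ) := by
  have hbd : ∀ q : X × Y, ‖⟪ψ (f q.1), φ q.2⟫‖ ≤ cψ * ‖φ q.2‖ := fun q =>
    (norm_inner_le_norm _ _).trans (mul_le_mul_of_nonneg_right (hψ _) (norm_nonneg _))
  have hψf : StronglyMeasurable (fun q : X × Y => ψ (f q.1)) := by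
    have : StronglyMeasurable ψ := StronglyMeasurable.of_discrete
    exact this.comp_measurable (hf.comp measurable_fst)
  have hi : Integrable (fun q : X × Y => ⟪ψ (f q.1), φ q.2⟫) (μ ⊗ₘ κ) :=
    (hφ.norm.const_mul cψ).mono' (hψf.aestronglyMeasurable.inner hφ.aestronglyMeasurable)
      (Filter.Eventually.of_forall hbd)
  have hae : ∀ᵐ x ∂μ, ∫ y, ⟪ψ (f x), φ y⟫ ∂(κ x) = ⟪ψ (f x), gStar φ κ x⟫ := by
    have := ((Measure.integrable_compProd_iff hφ.aestronglyMeasurable).1 hφ).1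
    filter_upwards [this] with x hx
    exact integral_inner hx _
  refine ⟨?_, ?_, ?_⟩
  · have := (show Integrable (fun q : X × Y => ⟪ψ (f q.1), φ q.2⟫)
      ((Kernel.const Unit μ ⊗ₖ Kernel.prodMkLeft Unit κ) ()) from hi).integral_compProd
    simp only [Kernel.const_apply, Kernel.prodMkLeft_apply] at this
    exact this.congr hae
  · rw [risk, Measure.integral_compProd hi]
    exact integral_congr_ae hae
  · rw [← Real.norm_eq_abs]
    exact norm_integral_le_of_norm_le (hφ.norm.const_mul cψ) (Filter.Eventually.of_forall hbd)

lemma aux_point (ψ : Z → H) (cψ : ℝ) (hψ : ∀ z, ‖ψ z‖ ≤ cψ) (ξ η : H) (z1 z2 : Z)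
    (h1 : ∀ z, ⟪ψ z1, ξ⟫ ≤ ⟪ψ z, ξ⟫) (h2 : ∀ z, ⟪ψ z2, η⟫ ≤ ⟪ψ z, η⟫) :
    ENNReal.ofReal (⟪ψ z2, ξ⟫ - ⟪ψ z1, ξ⟫) ≤ ENNReal.ofReal (4 * cψ) *
      ∫⁻ t in Set.Ioi (0:ℝ),
      Set.indicator {t : ℝ | dF ψ ξ < ENNReal.ofReal (2 * t) ∧ t < ‖η - ξ‖} 1 t := by
  by_cases hne : z1 = z2
  · simp [hne]
  have hc : 0 ≤ cψ := (norm_nonneg _).trans (hψ z1)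
  have hT := aux_tail ‖η - ξ‖ (norm_nonneg _) _ (aux_dF_le ψ hne h1 h2)
  calc _ ≤ ENNReal.ofReal (2 * cψ * ‖η - ξ‖) := by
        apply ENNReal.ofReal_le_ofReal
        have h3 : ⟪ψ z1 - ψ z2, η - ξ⟫ ≤ 2 * cψ * ‖η - ξ‖ := by
          refine (real_inner_le_norm _ _).trans ?_
          gcongr
          exact (norm_sub_le _ _).trans (by linarith [hψ z1, hψ z2])
        have h4 := h2 z1
        simp only [inner_sub_left, inner_sub_right] at h3
        linarith
    _ = ENNReal.ofReal (2 * cψ) * ENNReal.ofReal ‖η - ξ‖ := ENNReal.ofReal_mul (by positivity)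
    _ ≤ ENNReal.ofReal (2 * cψ) * (2 * _) := by gcongr
    _ = _ := by
        rw [← mul_assoc, show (2:ℝ≥0∞) = ENNReal.ofReal 2 by simp,
          ← ENNReal.ofReal_mul (by positivity)]
        congr 2; ring

/-- **Low-density rates under general exponential tails**: if the pointwise concentration of
the surrogate estimates is given by a finite sum of exponential tails
`Σᵢ aᵢ exp(−bᵢ t^{pᵢ})`, then under the `α`-margin condition the expected excess risk is
bounded by `c Σᵢ aᵢ bᵢ^{−(α+1)/pᵢ}`, where `c` depends only on `α`, `cα`, `cψ`, `m` and
`(pᵢ)` but not on `(aᵢ, bᵢ)`. -/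
theorem rates_low_density_general_tails
    (α cα cψ : ℝ) (hα : 0 < α) (hcα : 0 < cα)
    (m : ℕ) (p : Fin m → ℝ) (hp : ∀ i, 0 < p i) :
    ∃ c : ℝ, 0 < c ∧
      ∀ (X : Type uX) (Y : Type uY) (Z : Type uZ) (H : Type uH) (Ω : Type uO)
        [TopologicalSpace X] [PolishSpace X] [MeasurableSpace X] [BorelSpace X]
        [MeasurableSpace Y] [MeasurableSpace Ω]
        [Fintype Z] [Nonempty Z] [MeasurableSpace Z] [MeasurableSingletonClass Z]
        [NormedAddCommGroup H] [InnerProductSpace ℝ H] [CompleteSpace H]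
        [SecondCountableTopology H] [MeasurableSpace H] [BorelSpace H]
        (ψ : Z → H) (φ : Y → H), (∀ z, ‖ψ z‖ ≤ cψ) → Measurable φ →
      ∀ (μ : Measure X), IsProbabilityMeasure μ →
      ∀ (κ : Kernel X Y), IsMarkovKernel κ →
        Integrable (fun pt : X × Y => ‖φ pt.2‖ ^ 2) (μ ⊗ₘ κ) →
        (∀ t : ℝ, 0 < t →
          μ {x | dF ψ (gStar φ κ x) < ENNReal.ofReal t} ≤ ENNReal.ofReal (cα * t ^ α)) →
      ∀ (P : Measure Ω), IsProbabilityMeasure P →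
      ∀ (gn : Ω → X → H), Measurable (Function.uncurry gn) →
      ∀ a b : Fin m → ℝ, (∀ i, 0 < a i) → (∀ i, 0 < b i) →
        (∀ t : ℝ, 0 < t → ∀ x ∈ msupp μ,
          P {ω | t < ‖gn ω x - gStar φ κ x‖}
            ≤ ENNReal.ofReal (∑ i, a i * exp (-(b i * t ^ (p i))))) →
      ∀ (fn : Ω → X → Z), (∀ ω, IsDecoding ψ (gn ω) (fn ω)) →
        Measurable (Function.uncurry fn) →
      ∀ (fstar : X → Z), IsDecoding ψ (gStar φ κ) fstar →
        (∫ ω, risk ψ φ (μ ⊗ₘ κ) (fn ω) ∂P) - risk ψ φ (μ ⊗ₘ κ) fstar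
          ≤ c * ∑ i, a i * b i ^ (-(α + 1) / p i) := by
  let K : Fin m → ℝ := fun i => cα * 2 ^ α * (1 / p i) * Gamma ((α + 1) / p i)
  have hK : ∀ i, 0 ≤ K i := fun i => by
    have := hp i
    have h2 : 0 < Gamma ((α + 1) / p i) := Gamma_pos_of_pos (by positivity)
    positivity
  have hKs : 0 ≤ ∑ i, K i := Finset.sum_nonneg fun i _ => hK i
  refine ⟨1 + 4 * |cψ| * ∑ i, K i, by positivity, ?_⟩
  intro X Y Z H Ω _ _ _ _ _ _ _ _ _ _ _ _ _ _ _ _ ψ φ hψ hφ μ hμ κ hκ hsq hmargin P hP gn hgn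
    a b ha hb htail fn hfn hfnm fstar hfs
  have hc : 0 ≤ cψ := (norm_nonneg _).trans (hψ (Classical.arbitrary Z))
  have hφs : StronglyMeasurable φ := hφ.stronglyMeasurable
  have hφi := aux_phi φ μ κ hφs hsq
  have hg : Measurable (gStar φ κ) :=
    (StronglyMeasurable.integral_kernel hφs (κ := κ)).measurable
  have hd : Measurable (fun x => dF ψ (gStar φ κ x)) :=
    (Metric.continuous_infEDist (s := decisionFrontier ψ)).measurable.comp hg
  have hR := fun (f : X → Z) (hf : Measurable f) => aux_risk ψ φ μ κ cψ hψ hφi f hf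
  have hrm : StronglyMeasurable (fun ω => risk ψ φ (μ ⊗ₘ κ) (fn ω)) := by
    have h1 : StronglyMeasurable (fun q : Ω × (X × Y) => ψ (fn q.1 q.2.1)) := by
      have : StronglyMeasurable ψ := StronglyMeasurable.of_discrete
      exact this.comp_measurable (hfnm.comp (by fun_prop :
        Measurable (fun q : Ω × (X × Y) => (q.1, q.2.1))))
    have h2 : StronglyMeasurable (fun q : Ω × (X × Y) => φ q.2.2) :=
      hφs.comp_measurable (by fun_prop)
    exact (h1.inner h2 (𝕜 := ℝ)).integral_prod_right'
  have hri : Integrable (fun ω => risk ψ φ (μ ⊗ₘ κ) (fn ω)) P :=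
    (integrable_const (∫ q, cψ * ‖φ q.2‖ ∂(μ ⊗ₘ κ))).mono' hrm.aestronglyMeasurable
      (Filter.Eventually.of_forall fun ω => (hR _ (hfn ω).1).2.2)
  have hD : ∀ ω, risk ψ φ (μ ⊗ₘ κ) (fn ω) - risk ψ φ (μ ⊗ₘ κ) fstar
      = ∫ x, (⟪ψ (fn ω x), gStar φ κ x⟫ - ⟪ψ (fstar x), gStar φ κ x⟫) ∂μ := fun ω => by
    rw [(hR _ (hfn ω).1).2.1, (hR _ hfs.1).2.1,
      integral_sub (hR _ (hfn ω).1).1 (hR _ hfs.1).1]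
  have hD0 : ∀ ω, 0 ≤ risk ψ φ (μ ⊗ₘ κ) (fn ω) - risk ψ φ (μ ⊗ₘ κ) fstar := fun ω => by
    rw [hD]
    exact integral_nonneg fun x => sub_nonneg.2 (hfs.2 x _)
  have hsum : ∀ i, 0 ≤ a i * b i ^ (-(α + 1) / p i) := fun i => by
    have := ha i
    have := hb i
    positivity
  have hton := aux_tonelli α cα hα hcα m p hp a b ha hb μ P
    (fun ω x => ‖gn ω x - gStar φ κ x‖)
    ((hgn.sub (hg.comp measurable_snd)).norm) _ hd hmargin (by
      filter_upwards [Measure.support_mem_ae (μ := μ)] with x hx t ht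
      refine htail t ht x ?_
      intro U hU hxU
      exact (Measure.mem_support_iff_forall x).1 hx U (hU.mem_nhds hxU))
  have hmain : ∫ ω, (risk ψ φ (μ ⊗ₘ κ) (fn ω) - risk ψ φ (μ ⊗ₘ κ) fstar) ∂P
      ≤ 4 * cψ * ∑ i, K i * (a i * b i ^ (-(α + 1) / p i)) := by
    have hS0 : 0 ≤ ∑ i, K i * (a i * b i ^ (-(α + 1) / p i)) :=
      Finset.sum_nonneg fun i _ => mul_nonneg (hK i) (hsum i)
    rw [← ENNReal.ofReal_le_ofReal_iff (by positivity),
      ofReal_integral_eq_lintegral_ofReal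
        (f := fun ω => risk ψ φ (μ ⊗ₘ κ) (fn ω) - risk ψ φ (μ ⊗ₘ κ) fstar)
        (hri.sub (integrable_const _))
        (Filter.Eventually.of_forall hD0), ENNReal.ofReal_mul (by positivity)]
    refine le_trans ?_ (mul_le_mul_right hton _)
    rw [← lintegral_const_mul' _ _ ENNReal.ofReal_ne_top]
    refine lintegral_mono fun ω => ?_
    dsimp only
    rw [hD ω, ofReal_integral_eq_lintegral_ofReal
      (f := fun x => ⟪ψ (fn ω x), gStar φ κ x⟫ - ⟪ψ (fstar x), gStar φ κ x⟫)
      ((hR _ (hfn ω).1).1.sub (hR _ hfs.1).1)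
      (Filter.Eventually.of_forall fun x => sub_nonneg.2 (hfs.2 x _)),
      ← lintegral_const_mul' _ _ ENNReal.ofReal_ne_top]
    refine lintegral_mono fun x => ?_
    exact aux_point ψ cψ hψ _ _ _ _ (hfs.2 x) ((hfn ω).2 x)
  rw [integral_sub hri (integrable_const _)] at hmain
  simp only [integral_const, probReal_univ, one_smul] at hmain
  refine hmain.trans ?_
  have hs0 : 0 ≤ ∑ i, a i * b i ^ (-(α + 1) / p i) := Finset.sum_nonneg fun i _ => hsum i
  have hle : ∑ i, K i * (a i * b i ^ (-(α + 1) / p i))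
      ≤ (∑ i, K i) * ∑ i, a i * b i ^ (-(α + 1) / p i) := by
    rw [Finset.sum_mul]
    refine Finset.sum_le_sum fun i _ => mul_le_mul_of_nonneg_left ?_ (hK i)
    exact Finset.single_le_sum (f := fun i => a i * b i ^ (-(α + 1) / p i))
      (fun j _ => hsum j) (Finset.mem_univ i)
  rw [abs_of_nonneg hc]
  have := mul_le_mul_of_nonneg_left hle (by positivity : 0 ≤ 4 * cψ)
  nlinarith

end
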